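/- arXiv:2002.09466 — 3 statements merged into one kernel-verified Lean document; each statement's English description precedes it below -/
import Mathlib

section
/- The piecewise polynomial Q satisfies the symmetry Q(α) + Q(3−α) = 42 for every real α. -/
/-- The conjectured value `Q = 9!·M₃` of the normalized mean square of long Dirichlet
polynomials with coefficients `d₃(n)`, as a piecewise polynomial. -/
noncomputable def Qcal (α : ℝ) : ℝ :=
  if α < 0 then 0
  else if α ≤ 1 then α ^ 9
  else if α ≤ 2 then
    -2 * α ^ 9 + 27 * α ^ 8 - 324 * α ^ 7 + 2268 * α ^ 6 - 8694 * α ^ 5 + 19278 * α ^ 4 -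
      25452 * α ^ 3 + 19764 * α ^ 2 - 8343 * α + 1479
  else if α ≤ 3 then
    α ^ 9 - 27 * α ^ 8 + 324 * α ^ 7 - 2268 * α ^ 6 + 10206 * α ^ 5 - 30618 * α ^ 4 +
      61236 * α ^ 3 - 78732 * α ^ 2 + 59049 * α - 19641
  else 42

theorem Qcal_of_neg {α : ℝ} (h : α < 0) : Qcal α = 0 := if_pos h

theorem Qcal_of_mem_Icc_zero_one {α : ℝ} (h : α ∈ Set.Icc 0 1) : Qcal α = α ^ 9 := by
  rw [Qcal, if_neg h.1.not_gt, if_pos h.2]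

theorem Qcal_of_mem_Icc_one_two {α : ℝ} (h : α ∈ Set.Icc 1 2) :
    Qcal α = -2 * α ^ 9 + 27 * α ^ 8 - 324 * α ^ 7 + 2268 * α ^ 6 - 8694 * α ^ 5 +
      19278 * α ^ 4 - 25452 * α ^ 3 + 19764 * α ^ 2 - 8343 * α + 1479 := by
  obtain ⟨h₁, h₂⟩ := h
  rcases h₁.eq_or_lt with rfl | h₁
  · norm_num [Qcal]
  · rw [Qcal, if_neg (by linarith), if_neg h₁.not_ge, if_pos h₂]

theorem Qcal_of_mem_Icc_two_three {α : ℝ} (h : α ∈ Set.Icc 2 3) :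
    Qcal α = α ^ 9 - 27 * α ^ 8 + 324 * α ^ 7 - 2268 * α ^ 6 + 10206 * α ^ 5 -
      30618 * α ^ 4 + 61236 * α ^ 3 - 78732 * α ^ 2 + 59049 * α - 19641 := by
  obtain ⟨h₁, h₂⟩ := h
  rcases h₁.eq_or_lt with rfl | h₁
  · norm_num [Qcal]
  · rw [Qcal, if_neg (by linarith), if_neg (by linarith), if_neg h₁.not_ge, if_pos h₂]

theorem Qcal_of_three_lt {α : ℝ} (h : 3 < α) : Qcal α = 42 := by
  rw [Qcal, if_neg (by linarith), if_neg (by linarith), if_neg (by linarith), if_neg h.not_ge]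

/-- The piecewise polynomial `Q` satisfies `Q(α) + Q(3-α) = 42`. -/
theorem Q_symmetry : ∀ α : ℝ, Qcal α + Qcal (3 - α) = 42 := by
  intro α
  wlog hα : α ≤ 3 / 2 generalizing α
  · have h := this (3 - α) (by linarith)
    rwa [sub_sub_cancel, add_comm] at h
  rcases lt_or_ge α 0 with h₀ | h₀
  · rw [Qcal_of_neg h₀, Qcal_of_three_lt (by linarith), zero_add]
  rcases le_total α 1 with h₁ | h₁
  · rw [Qcal_of_mem_Icc_zero_one ⟨h₀, h₁⟩,
      Qcal_of_mem_Icc_two_three ⟨by linarith, by linarith⟩]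
    ring
  · rw [Qcal_of_mem_Icc_one_two ⟨h₁, by linarith⟩,
      Qcal_of_mem_Icc_one_two ⟨by linarith, by linarith⟩]
    ring
end

section
/- Let f: ℝ → ℝ satisfy: f(α) = 0 for α < 0; f(α) = α^9 for 0 ≤ α ≤ 1; the restriction of f to [1,2] agrees with a polynomial of degree at most 9; f(α) + f(3−α) = 42 for every real α; and f is four times continuously differentiable on a neighborhood of α = 1. Then f = Q identically; in particular f is uniquely determined by these conditions. -/
open Polynomial in
theorem Polynomial.iteratedDeriv_eval (p : ℝ[X]) (k : ℕ) :
    iteratedDeriv k (fun x => p.eval x) = fun x => (derivative^[k] p).eval x := by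
  induction k with
  | zero => simp
  | succ k ih =>
    funext x
    rw [iteratedDeriv_succ, ih, Polynomial.deriv, Function.iterate_succ_apply']

open Polynomial Topology in
/-- If a function of class `C^n` at `a` agrees with a polynomial `p` near `a` on an open set
accumulating at `a`, then its derivatives up to order `n` at `a` are those of `p`. -/
theorem iteratedDeriv_eq_eval_iterate_derivative_of_eventuallyEq {f : ℝ → ℝ} {p : ℝ[X]}
    {a : ℝ} {s : Set ℝ} {n k : ℕ} (hs : IsOpen s) [(𝓝[s] a).NeBot]
    (hf : ContDiffAt ℝ n f a) (hk : k ≤ n) (hfp : f =ᶠ[𝓝[s] a] fun x => p.eval x) :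
    iteratedDeriv k f a = (derivative^[k] p).eval a := by
  have hcont : ContinuousAt (iteratedDeriv k f) a := by
    have h := hf.continuousAt_iteratedFDeriv (by exact_mod_cast hk)
    exact ((ContinuousMultilinearMap.apply ℝ (fun _ : Fin k => ℝ) ℝ
      fun _ => 1).continuous.continuousAt).comp h
  have heq : iteratedDeriv k f =ᶠ[𝓝[s] a] fun x => (derivative^[k] p).eval x := by
    filter_upwards [eventually_eventually_nhdsWithin.2 hfp, self_mem_nhdsWithin] with x hx hxs
    rw [hs.nhdsWithin_eq hxs] at hx
    rw [Filter.EventuallyEq.iteratedDeriv_eq k hx, p.iteratedDeriv_eval]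
  exact tendsto_nhds_unique (hcont.tendsto.mono_left nhdsWithin_le_nhds)
    (((derivative^[k] p).continuous.continuousAt.mono_left nhdsWithin_le_nhds).congr' heq.symm)

open Polynomial in
/-- Polynomials with equal derivatives at `a` up to order `n` are congruent modulo
`(X - a)^(n + 1)`. -/
theorem X_sub_C_pow_dvd_sub_of_eval_iterate_derivative_eq {p q : ℝ[X]} {a : ℝ} {n : ℕ}
    (h : ∀ k ≤ n, (derivative^[k] p).eval a = (derivative^[k] q).eval a) :
    (X - C a) ^ (n + 1) ∣ p - q := by
  rcases eq_or_ne (p - q) 0 with h0 | h0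
  · simp [h0]
  · rw [← le_rootMultiplicity_iff h0, Nat.succ_le_iff,
      lt_rootMultiplicity_iff_isRoot_iterate_derivative h0]
    intro k hk
    simp [h k hk]

open Polynomial in
/-- A polynomial of degree less than `2n` which is antisymmetric about the midpoint of `a ≠ b`
and vanishes to order `n` at `a` is zero. -/
theorem eq_zero_of_X_sub_C_pow_dvd_of_comp_eq_neg {p : ℝ[X]} {a b : ℝ} {n : ℕ} (hab : a ≠ b)
    (hdeg : p.natDegree < 2 * n) (hdvd : (X - C a) ^ n ∣ p)
    (hsymm : p.comp (C (a + b) - X) = -p) : p = 0 := by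
  have hdvd' : (X - C b) ^ n ∣ p := by
    obtain ⟨r, hr⟩ := hdvd
    rw [← dvd_neg, ← hsymm, hr, mul_comp, pow_comp]
    refine Dvd.dvd.mul_right (pow_dvd_pow_of_dvd ⟨-1, ?_⟩ n) _
    simp only [sub_comp, X_comp, C_comp, C_add]
    ring
  have hmul : (X - C a) ^ n * (X - C b) ^ n ∣ p :=
    ((isCoprime_X_sub_C_of_isUnit_sub (sub_ne_zero.2 hab).isUnit).pow).mul_dvd hdvd hdvd'
  refine eq_zero_of_dvd_of_natDegree_lt hmul ?_
  rw [((monic_X_sub_C a).pow n).natDegree_mul ((monic_X_sub_C b).pow n)]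
  simp only [natDegree_pow, natDegree_X_sub_C]
  omega

open Polynomial in
/-- The polynomial giving the values of `Qcal` on `[1, 2]`. -/
noncomputable def middlePoly : ℝ[X] :=
  -2 * X ^ 9 + 27 * X ^ 8 - 324 * X ^ 7 + 2268 * X ^ 6 - 8694 * X ^ 5 + 19278 * X ^ 4 -
    25452 * X ^ 3 + 19764 * X ^ 2 - 8343 * X + 1479

open Polynomial in
theorem natDegree_middlePoly_le : middlePoly.natDegree ≤ 9 := by
  unfold middlePoly
  compute_degree

open Polynomial in
theorem X_sub_one_pow_dvd_middlePoly_sub : (X - C 1) ^ 5 ∣ middlePoly - X ^ 9 :=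
  ⟨-3 * X ^ 4 + 12 * X ^ 3 - 234 * X ^ 2 + 948 * X - 1479, by
    rw [middlePoly, C_1]
    ring⟩

open Polynomial Topology in
/-- The smoothness and the symmetry of `f` determine its polynomial on `[1, 2]`. -/
theorem eq_middlePoly {f : ℝ → ℝ} {p : ℝ[X]} (hf1 : ∀ x, 0 ≤ x → x ≤ 1 → f x = x ^ 9)
    (hdeg : p.natDegree ≤ 9) (hfp : ∀ x ∈ Set.Icc (1 : ℝ) 2, f x = p.eval x)
    (hsymm : ∀ x, f x + f (3 - x) = 42) (hf : ContDiffAt ℝ 4 f 1) : p = middlePoly := by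
  have hleft : f =ᶠ[𝓝[<] 1] fun x => (X ^ 9 : ℝ[X]).eval x := by
    filter_upwards [Ioo_mem_nhdsLT (zero_lt_one' ℝ)] with x hx
    simpa using hf1 x hx.1.le hx.2.le
  have hright : f =ᶠ[𝓝[>] 1] fun x => p.eval x := by
    filter_upwards [Ioo_mem_nhdsGT (one_lt_two (α := ℝ))] with x hx
    exact hfp x ⟨hx.1.le, hx.2.le⟩
  have hdvd : (X - C 1) ^ 5 ∣ p - X ^ 9 :=
    X_sub_C_pow_dvd_sub_of_eval_iterate_derivative_eq fun k hk => by
      rw [← iteratedDeriv_eq_eval_iterate_derivative_of_eventuallyEq isOpen_Ioi hf hk hright,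
        ← iteratedDeriv_eq_eval_iterate_derivative_of_eventuallyEq isOpen_Iio hf hk hleft]
  refine sub_eq_zero.1 (eq_zero_of_X_sub_C_pow_dvd_of_comp_eq_neg (a := 1) (b := 2) (n := 5)
    (by norm_num) ?_ ?_ ?_)
  · exact (natDegree_sub_le_of_le hdeg natDegree_middlePoly_le).trans_lt (by norm_num)
  · simpa using dvd_sub hdvd X_sub_one_pow_dvd_middlePoly_sub
  · refine eq_of_infinite_eval_eq _ _ ((Set.Icc_infinite (one_lt_two (α := ℝ))).mono ?_)
    intro x hx
    have h := hsymm x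
    rw [hfp x hx, hfp (3 - x) ⟨by linarith [hx.2], by linarith [hx.1]⟩] at h
    simp only [Set.mem_ofPred_eq, eval_comp, eval_sub, eval_neg, eval_C, eval_X, middlePoly,
      eval_add, eval_mul, eval_pow, eval_ofNat]
    norm_num at h ⊢
    linear_combination h

/-- A function that vanishes on `(-∞,0)`, equals `α^9` on `[0,1]`, is a
polynomial of degree at most `9` on `[1,2]`, satisfies the symmetry `f(α)+f(3-α) = 42`, and
is four times continuously differentiable near `α = 1`, must be equal to `Q`. -/
theorem Q_uniqueness (f : ℝ → ℝ)
    (h0 : ∀ α : ℝ, α < 0 → f α = 0)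
    (h1 : ∀ α : ℝ, 0 ≤ α → α ≤ 1 → f α = α ^ 9)
    (h2 : ∃ p : Polynomial ℝ, p.natDegree ≤ 9 ∧ ∀ α ∈ Set.Icc (1:ℝ) 2, f α = p.eval α)
    (h3 : ∀ α : ℝ, f α + f (3 - α) = 42)
    (h4 : ∃ u : Set ℝ, IsOpen u ∧ (1:ℝ) ∈ u ∧ ContDiffOn ℝ 4 f u) :
    f = Qcal := by
  obtain ⟨p, hdeg, hfp⟩ := h2
  obtain ⟨u, hu, h1u, hfu⟩ := h4
  have hp := eq_middlePoly h1 hdeg hfp h3 (hfu.contDiffAt (hu.mem_nhds h1u))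
  funext x
  have hx := h3 x
  unfold Qcal
  split_ifs with hx0 hx1 hx2 hx3
  · exact h0 x hx0
  · exact h1 x (not_lt.1 hx0) hx1
  · rw [hfp x ⟨(not_le.1 hx1).le, hx2⟩, hp]
    simp [middlePoly]
  · rw [h1 (3 - x) (by linarith) (by linarith)] at hx
    linear_combination hx
  · rw [h0 (3 - x) (by linarith)] at hx
    linarith
end

section
/- For all integers N ≥ 1 and k ≥ 1 there exists a polynomial F ∈ ℂ[X] of degree at most kN such that for all z_1, z_2 ∈ ℂ: ∫_{U(N)} det(I_N + z_1 A)^k · det(I_N + z_2 A*)^k dA = F(z_1 z_2). In particular the left-hand side depends on (z_1, z_2) only through the product z_1 z_2. -/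
open MeasureTheory Polynomial Finset

noncomputable instance (N : ℕ) : MeasurableSpace (Matrix (Fin N) (Fin N) ℂ) :=
  MeasurableSpace.pi

/-- The polynomial `det(1 + X B)` of a square matrix `B` over a commutative ring. -/
noncomputable def detOneAddXSmul {N : ℕ} {R : Type*} [CommRing R]
    (B : Matrix (Fin N) (Fin N) R) : R[X] :=
  ((X : R[X]) • B.map C + (1 : Matrix (Fin N) (Fin N) R).map C).det

theorem natDegree_detOneAddXSmul_pow_le {N : ℕ} {R : Type*} [CommRing R]
    (B : Matrix (Fin N) (Fin N) R) (k : ℕ) :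
    (detOneAddXSmul B ^ k).natDegree ≤ k * N := by
  refine natDegree_pow_le.trans (Nat.mul_le_mul_left k ?_)
  simpa only [detOneAddXSmul, Fintype.card_fin] using natDegree_det_X_add_C_le B 1

theorem eval_detOneAddXSmul {N : ℕ} {R : Type*} [CommRing R]
    (B : Matrix (Fin N) (Fin N) R) (z : R) :
    (detOneAddXSmul B).eval z = (1 + z • B).det := by
  rw [detOneAddXSmul, ← coe_evalRingHom, RingHom.map_det]
  congr 1
  ext i j
  by_cases h : i = j <;> simp [h, add_comm] <;> ring

theorem map_detOneAddXSmul {N : ℕ} {R S : Type*} [CommRing R] [CommRing S] (f : R →+* S)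
    (B : Matrix (Fin N) (Fin N) R) :
    (detOneAddXSmul B).map f = detOneAddXSmul (B.map f) := by
  rw [detOneAddXSmul, detOneAddXSmul, ← coe_mapRingHom, RingHom.map_det]
  congr 1
  ext1 i j
  by_cases h : i = j <;> simp [h]

theorem coeff_detOneAddXSmul_smul_pow {N : ℕ} (B : Matrix (Fin N) (Fin N) ℂ) (w : ℂ) (k i : ℕ) :
    (detOneAddXSmul (w • B) ^ k).coeff i = (detOneAddXSmul B ^ k).coeff i * w ^ i := by
  have h : detOneAddXSmul (w • B) ^ k = (detOneAddXSmul B ^ k).comp (C w * X) := by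
    refine Polynomial.funext fun z ↦ ?_
    simp only [eval_pow, eval_comp, eval_mul, eval_C, eval_X, eval_detOneAddXSmul, smul_smul]
    rw [mul_comm z w]
  rw [h, comp_C_mul_X_coeff]

instance (N : ℕ) : BorelSpace (Matrix (Fin N) (Fin N) ℂ) :=
  inferInstanceAs (BorelSpace (Fin N → Fin N → ℂ))

/-- The matrix of coordinate functions on the unitary group. -/
noncomputable def unitaryCoord (N : ℕ) :
    Matrix (Fin N) (Fin N)
      (BoundedContinuousFunction (Matrix.unitaryGroup (Fin N) ℂ) ℂ) :=
  fun i j ↦ BoundedContinuousFunction.ofNormedAddCommGroup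
    (fun A ↦ (A : Matrix (Fin N) (Fin N) ℂ) i j)
    ((continuous_apply_apply i j).comp continuous_subtype_val) 1
    (fun A ↦ entry_norm_bound_of_unitary A.2 i j)

/-- Evaluation of bounded continuous functions at a point. -/
noncomputable def evalBCF {α : Type*} [TopologicalSpace α] (a : α) :
    BoundedContinuousFunction α ℂ →+* ℂ where
  toFun f := f a
  map_one' := rfl
  map_mul' _ _ := rfl
  map_zero' := rfl
  map_add' _ _ := rfl

theorem exists_bcf_eq_coeff (N k i : ℕ) :
    ∃ f : BoundedContinuousFunction (Matrix.unitaryGroup (Fin N) ℂ) ℂ, ∀ A,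
      f A = (detOneAddXSmul (A : Matrix (Fin N) (Fin N) ℂ) ^ k).coeff i := by
  refine ⟨(detOneAddXSmul (unitaryCoord N) ^ k).coeff i, fun A ↦ ?_⟩
  change evalBCF A _ = _
  rw [← coeff_map, Polynomial.map_pow, map_detOneAddXSmul]
  rfl

theorem exists_bcf_eq_coeff_star (N k i : ℕ) :
    ∃ f : BoundedContinuousFunction (Matrix.unitaryGroup (Fin N) ℂ) ℂ, ∀ A,
      f A = (detOneAddXSmul (star (A : Matrix (Fin N) (Fin N) ℂ)) ^ k).coeff i := by
  refine ⟨(detOneAddXSmul (star (unitaryCoord N)) ^ k).coeff i, fun A ↦ ?_⟩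
  change evalBCF A _ = _
  rw [← coeff_map, Polynomial.map_pow, map_detOneAddXSmul]
  rfl

theorem integrable_coeff_mul_coeff_star {N : ℕ} (k i j : ℕ)
    (μ : Measure (Matrix.unitaryGroup (Fin N) ℂ)) [IsFiniteMeasure μ] :
    Integrable (fun A : Matrix.unitaryGroup (Fin N) ℂ ↦
      (detOneAddXSmul (A : Matrix (Fin N) (Fin N) ℂ) ^ k).coeff i *
        (detOneAddXSmul (star (A : Matrix (Fin N) (Fin N) ℂ)) ^ k).coeff j) μ := by
  obtain ⟨f, hf⟩ := exists_bcf_eq_coeff N k i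
  obtain ⟨g, hg⟩ := exists_bcf_eq_coeff_star N k j
  have : SecondCountableTopology (Matrix (Fin N) (Fin N) ℂ) :=
    inferInstanceAs (SecondCountableTopology (Fin N → Fin N → ℂ))
  exact ((f * g).integrable μ).congr (.of_forall fun A ↦ by simp [hf, hg])

theorem integral_comp_unitary_mul {N : ℕ} (μ : Measure (Matrix.unitaryGroup (Fin N) ℂ))
    [μ.IsMulLeftInvariant] (f : Matrix.unitaryGroup (Fin N) ℂ → ℂ)
    (U : Matrix.unitaryGroup (Fin N) ℂ) : ∫ A, f (U * A) ∂μ = ∫ A, f A ∂μ :=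
  ((Homeomorph.mulLeft U).measurableEmbedding.integral_map f).symm.trans
    (by rw [Homeomorph.coe_mulLeft, map_mul_left_eq_self])

theorem integral_coeff_mul_coeff_star_eq_zero {N : ℕ} {k i j : ℕ}
    (μ : Measure (Matrix.unitaryGroup (Fin N) ℂ)) [μ.IsMulLeftInvariant] (hij : i ≠ j) :
    ∫ A : Matrix.unitaryGroup (Fin N) ℂ,
      (detOneAddXSmul (A : Matrix (Fin N) (Fin N) ℂ) ^ k).coeff i *
        (detOneAddXSmul (star (A : Matrix (Fin N) (Fin N) ℂ)) ^ k).coeff j ∂μ = 0 := by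
  have hw := Complex.isPrimitiveRoot_exp (i + j + 1) (by omega)
  set w := Complex.exp (2 * Real.pi * Complex.I / (i + j + 1 : ℕ))
  have hw1 : star w * w = 1 := by
    have := Complex.normSq_eq_conj_mul_self (z := w)
    rw [Complex.normSq_eq_norm_sq, hw.norm'_eq_one (by omega)] at this
    simpa using this.symm
  have hU : w • (1 : Matrix (Fin N) (Fin N) ℂ) ∈ Matrix.unitaryGroup (Fin N) ℂ := by
    rw [Matrix.mem_unitaryGroup_iff', star_smul, star_one, smul_mul_smul_comm, hw1, one_mul,
      one_smul]
  have h := integral_comp_unitary_mul μ (fun A ↦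
      (detOneAddXSmul (A : Matrix (Fin N) (Fin N) ℂ) ^ k).coeff i *
        (detOneAddXSmul (star (A : Matrix (Fin N) (Fin N) ℂ)) ^ k).coeff j) ⟨_, hU⟩
  simp only [Submonoid.coe_mul, smul_mul_assoc, one_mul, star_smul,
    coeff_detOneAddXSmul_smul_pow] at h
  conv_lhs at h => enter [2, A]; rw [mul_mul_mul_comm]
  rw [integral_mul_const] at h
  by_contra h0
  have h1 : w ^ i * star w ^ j = 1 := mul_left_cancel₀ h0 (h.trans (mul_one _).symm)
  refine hij (hw.pow_inj (by omega) (by omega) ?_)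
  calc w ^ i = w ^ i * (star w * w) ^ j := by rw [hw1, one_pow, mul_one]
    _ = w ^ i * star w ^ j * w ^ j := by rw [mul_pow, mul_assoc]
    _ = w ^ j := by rw [h1, one_mul]

/-- The average over `U(N)` of `det(1+z₁A)^k det(1+z₂A*)^k` is a
polynomial of degree at most `kN` in the product `z₁z₂`. -/
theorem unitary_det_average_polynomial (N k : ℕ) (hN : 1 ≤ N) (hk : 1 ≤ k)
    (μ : Measure (Matrix.unitaryGroup (Fin N) ℂ))
    (hμ : μ.IsMulLeftInvariant) (hμ' : IsProbabilityMeasure μ) :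
    ∃ F : Polynomial ℂ, F.natDegree ≤ k * N ∧
      ∀ z₁ z₂ : ℂ,
        (∫ A, Matrix.det (1 + z₁ • (A : Matrix (Fin N) (Fin N) ℂ)) ^ k *
            Matrix.det (1 + z₂ • star (A : Matrix (Fin N) (Fin N) ℂ)) ^ k ∂μ) =
          F.eval (z₁ * z₂) := by
  let c : ℕ → ℕ → ℂ := fun i j ↦ ∫ A : Matrix.unitaryGroup (Fin N) ℂ,
    (detOneAddXSmul (A : Matrix (Fin N) (Fin N) ℂ) ^ k).coeff i *
      (detOneAddXSmul (star (A : Matrix (Fin N) (Fin N) ℂ)) ^ k).coeff j ∂μ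
  refine ⟨∑ i ∈ range (k * N + 1), C (c i i) * X ^ i, ?_, fun z₁ z₂ ↦ ?_⟩
  · refine natDegree_sum_le_of_forall_le _ _ fun i hi ↦ ?_
    exact (natDegree_C_mul_X_pow_le _ _).trans (Nat.le_of_lt_succ (mem_range.1 hi))
  have expand (B : Matrix (Fin N) (Fin N) ℂ) (z : ℂ) : (1 + z • B).det ^ k =
      ∑ i ∈ range (k * N + 1), (detOneAddXSmul B ^ k).coeff i * z ^ i := by
    rw [← eval_detOneAddXSmul, ← eval_pow]
    exact eval_eq_sum_range' (Nat.lt_succ_of_le (natDegree_detOneAddXSmul_pow_le B k)) z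
  have hint (i j : ℕ) := (integrable_coeff_mul_coeff_star k i j μ).mul_const (z₁ ^ i * z₂ ^ j)
  simp only [expand, sum_mul_sum]
  conv_lhs => enter [2, A, 2, i, 2, j]; rw [mul_mul_mul_comm]
  rw [integral_finsetSum _ fun i _ ↦ integrable_finsetSum _ fun j _ ↦ hint i j, eval_finsetSum]
  refine sum_congr rfl fun i hi ↦ ?_
  rw [integral_finsetSum _ fun j _ ↦ hint i j, sum_eq_single_of_mem i hi]
  · simp [integral_mul_const, mul_pow, c]
  · intro j _ hji
    rw [integral_mul_const, integral_coeff_mul_coeff_star_eq_zero μ hji.symm, zero_mul]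
end
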